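/- arXiv:1511.08780 — 3 statements merged into one kernel-verified Lean document; each statement's English description precedes it below -/
import Mathlib

section
/- Let O ⊆ ℂ be an open set, let w : O → ℂ be continuously real-differentiable with continuously real-differentiable Wirtinger derivatives, set γ = e^{2w}, and let u : O → ℂ be twice continuously real-differentiable and satisfy the conductivity equation ∂ₓ(γ·∂ₓu) + ∂ᵧ(γ·∂ᵧu) = 0 on O. Then the functions φ₁ := e^{w}·∂u and φ₂ := e^{w}·∂̄u satisfy the Dirac system ∂̄φ₁ = −(∂w)·φ₂ and ∂φ₂ = −(∂̄w)·φ₁ at every point of O. -/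
open Complex MeasureTheory Metric Set Filter

noncomputable section

/-- Wirtinger derivative ∂f(z) = (Df(z)(1) − i·Df(z)(i))/2, with Df the ℝ-linear Fréchet
derivative. -/
def wdz (f : ℂ → ℂ) (z : ℂ) : ℂ :=
  (fderiv ℝ f z 1 - Complex.I * fderiv ℝ f z Complex.I) / 2

/-- Conjugate Wirtinger derivative ∂̄f(z) = (Df(z)(1) + i·Df(z)(i))/2. -/
def wdzbar (f : ℂ → ℂ) (z : ℂ) : ℂ :=
  (fderiv ℝ f z 1 + Complex.I * fderiv ℝ f z Complex.I) / 2

theorem hasFDerivAt_fderiv_apply {u : ℂ → ℂ} {z : ℂ} (hu : ContDiffAt ℝ 2 u z) (v : ℂ) :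
    HasFDerivAt (fun ζ => fderiv ℝ u ζ v) ((fderiv ℝ (fderiv ℝ u) z).flip v) z := by
  have h : DifferentiableAt ℝ (fderiv ℝ u) z :=
    (hu.fderiv_right (m := 1) (by norm_num)).differentiableAt (by norm_num)
  simpa using h.hasFDerivAt.clm_apply (hasFDerivAt_const v z)

/-- if `u` solves the conductivity equation div(γ ∇u) = 0 on the open set `O`
with γ = e^{2w}, then φ₁ = e^{w}·∂u, φ₂ = e^{w}·∂̄u solve the Dirac system
∂̄φ₁ = −(∂w)·φ₂, ∂φ₂ = −(∂̄w)·φ₁ on `O`. -/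
theorem stmt0 (O : Set ℂ) (hO : IsOpen O) (w u γ : ℂ → ℂ)
    (hw : ContDiffOn ℝ 1 w O)
    (hwd : ContDiffOn ℝ 1 (wdz w) O)
    (hwdb : ContDiffOn ℝ 1 (wdzbar w) O)
    (hu : ContDiffOn ℝ 2 u O)
    (hγ : ∀ z, γ z = Complex.exp (2 * w z))
    (hcond : ∀ z ∈ O,
      fderiv ℝ (fun ζ => γ ζ * fderiv ℝ u ζ 1) z 1
        + fderiv ℝ (fun ζ => γ ζ * fderiv ℝ u ζ Complex.I) z Complex.I = 0) :
    ∀ z ∈ O,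
      wdzbar (fun ζ => Complex.exp (w ζ) * wdz u ζ) z
          = -(wdz w z) * (Complex.exp (w z) * wdzbar u z) ∧
        wdz (fun ζ => Complex.exp (w ζ) * wdzbar u ζ) z
          = -(wdzbar w z) * (Complex.exp (w z) * wdz u z) := by
  intro z hz
  have hwz : HasFDerivAt w (fderiv ℝ w z) z :=
    ((hw.contDiffAt (hO.mem_nhds hz)).differentiableAt (by norm_num)).hasFDerivAt
  have huz : ContDiffAt ℝ 2 u z := hu.contDiffAt (hO.mem_nhds hz)
  have hp := hasFDerivAt_fderiv_apply huz 1
  have hq := hasFDerivAt_fderiv_apply huz I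
  have hsymm : fderiv ℝ (fderiv ℝ u) z 1 I = fderiv ℝ (fderiv ℝ u) z I 1 :=
    (huz.isSymmSndFDerivAt (by simp)).eq 1 I
  have hdz : HasFDerivAt (wdz u) _ z := (hp.sub (hq.const_mul I)).mul_const (2⁻¹ : ℂ)
  have hdzbar : HasFDerivAt (wdzbar u) _ z := (hp.add (hq.const_mul I)).mul_const (2⁻¹ : ℂ)
  obtain rfl : γ = fun ζ => exp (2 * w ζ) := funext hγ
  have hγz := (hwz.const_mul 2).cexp
  have hc := hcond z hz
  beta_reduce at hc
  rw [(hγz.fun_mul hp).fderiv, (hγz.fun_mul hq).fderiv] at hc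
  have hlap : 2 * (fderiv ℝ w z 1 * fderiv ℝ u z 1 + fderiv ℝ w z I * fderiv ℝ u z I)
      + (fderiv ℝ (fderiv ℝ u) z 1 1 + fderiv ℝ (fderiv ℝ u) z I I) = 0 := by
    refine (mul_eq_zero.mp ?_).resolve_left (Complex.exp_ne_zero (2 * w z))
    simp at hc
    linear_combination hc
  have hφ₁ := (hwz.cexp.fun_mul hdz).fderiv
  have hφ₂ := (hwz.cexp.fun_mul hdzbar).fderiv
  constructor
  · rw [wdzbar, hφ₁]
    simp [wdz, wdzbar]
    linear_combination (exp (w z) / 4) * hlap - (exp (w z) * I / 4) * hsymm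
      - exp (w z) * (fderiv ℝ u z I * fderiv ℝ w z I / 2 + fderiv ℝ (fderiv ℝ u) z I I / 4) * I_sq
  · rw [wdz, hφ₂]
    simp [wdz, wdzbar]
    linear_combination (exp (w z) / 4) * hlap + (exp (w z) * I / 4) * hsymm
      - exp (w z) * (fderiv ℝ u z I * fderiv ℝ w z I / 2 + fderiv ℝ (fderiv ℝ u) z I I / 4) * I_sq

end
end

section
/- Let w : ℂ → ℂ be continuously real-differentiable and set γ = e^{2w}. Let φ₁, φ₂ : ℂ → ℂ be continuously real-differentiable functions satisfying the Dirac system ∂̄φ₁ = −(∂w)·φ₂ and ∂φ₂ = −(∂̄w)·φ₁ on all of ℂ. Then there exists a twice continuously real-differentiable function U : ℂ → ℂ such that ∂U = e^{−w}·φ₁ and ∂̄U = e^{−w}·φ₂ on ℂ, and this U satisfies the conductivity equation ∂ₓ(γ·∂ₓU) + ∂ᵧ(γ·∂ᵧU) = 0 on ℂ. -/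
open Complex MeasureTheory Metric Set Filter

noncomputable section

/-- Poincaré lemma on the plane: a closed `C¹` form `P dx + Q dy` has a `C²` primitive. -/
theorem exists_contDiff_two_of_fderiv_eq {E : Type*} [NormedAddCommGroup E] [NormedSpace ℝ E]
    [CompleteSpace E] {P Q : ℂ → E} (hP : ContDiff ℝ 1 P) (hQ : ContDiff ℝ 1 Q)
    (hPQ : ∀ z, fderiv ℝ P z Complex.I = fderiv ℝ Q z 1) :
    ∃ U : ℂ → E, ContDiff ℝ 2 U ∧
      ∀ z, fderiv ℝ U z 1 = P z ∧ fderiv ℝ U z Complex.I = Q z := by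
  set R := ContinuousLinearMap.smulRightL ℝ ℂ E Complex.reCLM
  set S := ContinuousLinearMap.smulRightL ℝ ℂ E Complex.imCLM
  have hω : ContDiff ℝ 1 fun z => R (P z) + S (Q z) :=
    (R.contDiff.comp hP).add (S.contDiff.comp hQ)
  have hsymm : ∀ z x y, fderiv ℝ (fun z => R (P z) + S (Q z)) z x y =
      fderiv ℝ (fun z => R (P z) + S (Q z)) z y x := by
    intro z x y
    have hd : HasFDerivAt (fun z => R (P z) + S (Q z))
        (R.comp (fderiv ℝ P z) + S.comp (fderiv ℝ Q z)) z :=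
      (R.hasFDerivAt.comp z (hP.differentiable one_ne_zero z).hasFDerivAt).add
        (S.hasFDerivAt.comp z (hQ.differentiable one_ne_zero z).hasFDerivAt)
    have key : ∀ (L : ℂ →L[ℝ] E) (v : ℂ), L v = v.re • L 1 + v.im • L Complex.I := by
      intro L v
      rw [← map_smul, ← map_smul, ← map_add]
      congr 1
      apply Complex.ext <;> simp
    rw [hd.fderiv]
    simp only [add_apply, ContinuousLinearMap.comp_apply, R, S,
      ContinuousLinearMap.smulRightL_apply_apply, ContinuousLinearMap.smulRight_apply,
      Complex.reCLM_apply, Complex.imCLM_apply]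
    rw [key (fderiv ℝ P z) x, key (fderiv ℝ P z) y, key (fderiv ℝ Q z) x,
      key (fderiv ℝ Q z) y, hPQ z]
    module
  obtain ⟨U, hU⟩ := convex_univ.exists_forall_hasFDerivAt_of_fderiv_symmetric isOpen_univ
    (hω.differentiable one_ne_zero).differentiableOn fun z _ => hsymm z
  have hU' : fderiv ℝ U = fun z => R (P z) + S (Q z) := funext fun z => (hU z (mem_univ z)).fderiv
  refine ⟨U, ?_, fun z => ?_⟩
  · rw [show (2 : WithTop ℕ∞) = 1 + 1 from one_add_one_eq_two.symm, contDiff_succ_iff_fderiv]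
    exact ⟨fun z => (hU z (mem_univ z)).differentiableAt, by simp, hU' ▸ hω⟩
  · simp [hU', R, S]

theorem fderiv_exp_mul_apply {a f : ℂ → ℂ} {z : ℂ} (ha : DifferentiableAt ℝ a z)
    (hf : DifferentiableAt ℝ f z) (v : ℂ) :
    fderiv ℝ (fun ζ => Complex.exp (a ζ) * f ζ) z v =
      Complex.exp (a z) * (fderiv ℝ a z v * f z + fderiv ℝ f z v) := by
  rw [(ha.hasFDerivAt.cexp.fun_mul hf.hasFDerivAt).fderiv]
  simp only [add_apply, smul_apply, smul_eq_mul]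
  ring

/-- given C¹ solutions φ₁, φ₂ of the Dirac system ∂̄φ₁ = −(∂w)·φ₂,
∂φ₂ = −(∂̄w)·φ₁ on ℂ (with γ = e^{2w}), there is a C² function U with
∂U = e^{−w}·φ₁, ∂̄U = e^{−w}·φ₂ which solves the conductivity equation
∂ₓ(γ ∂ₓU) + ∂ᵧ(γ ∂ᵧU) = 0 on ℂ. -/
theorem stmt1 (w φ₁ φ₂ γ : ℂ → ℂ)
    (hw : ContDiff ℝ 1 w) (h1 : ContDiff ℝ 1 φ₁) (h2 : ContDiff ℝ 1 φ₂)
    (hγ : ∀ z, γ z = Complex.exp (2 * w z))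
    (hd1 : ∀ z, wdzbar φ₁ z = -(wdz w z) * φ₂ z)
    (hd2 : ∀ z, wdz φ₂ z = -(wdzbar w z) * φ₁ z) :
    ∃ U : ℂ → ℂ, ContDiff ℝ 2 U ∧
      (∀ z, wdz U z = Complex.exp (-(w z)) * φ₁ z
        ∧ wdzbar U z = Complex.exp (-(w z)) * φ₂ z) ∧
      (∀ z, fderiv ℝ (fun ζ => γ ζ * fderiv ℝ U ζ 1) z 1
        + fderiv ℝ (fun ζ => γ ζ * fderiv ℝ U ζ Complex.I) z Complex.I = 0) := by
  have dw : Differentiable ℝ w := hw.differentiable one_ne_zero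
  have d1 : Differentiable ℝ φ₁ := h1.differentiable one_ne_zero
  have d2 : Differentiable ℝ φ₂ := h2.differentiable one_ne_zero
  have hneg : ContDiff ℝ 1 fun z => Complex.exp (-(w z)) := hw.neg.cexp
  simp only [wdz, wdzbar] at hd1 hd2 ⊢
  have hI := Complex.I_mul_I
  obtain ⟨U, hU, hD⟩ := exists_contDiff_two_of_fderiv_eq
    (P := fun z => Complex.exp (-(w z)) * (φ₁ z + φ₂ z))
    (Q := fun z => Complex.exp (-(w z)) * (Complex.I * (φ₁ z - φ₂ z)))
    (hneg.mul (h1.add h2)) (hneg.mul (contDiff_const.mul (h1.sub h2))) fun z => by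
      rw [fderiv_exp_mul_apply (dw z).fun_neg ((d1 z).fun_add (d2 z)),
        fderiv_exp_mul_apply (dw z).fun_neg (((d1 z).fun_sub (d2 z)).const_mul Complex.I),
        fderiv_fun_neg, fderiv_fun_add (d1 z) (d2 z),
        fderiv_const_mul ((d1 z).fun_sub (d2 z)), fderiv_fun_sub (d1 z) (d2 z)]
      simp only [neg_apply, add_apply, sub_apply, smul_apply, smul_eq_mul]
      linear_combination -2 * Complex.I * Complex.exp (-(w z)) * (hd1 z - hd2 z) +
        Complex.exp (-(w z)) * (fderiv ℝ φ₁ z Complex.I + fderiv ℝ φ₂ z Complex.I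
          - fderiv ℝ w z Complex.I * (φ₁ z + φ₂ z)) * hI
  refine ⟨U, hU, fun z => ?_, fun z => ?_⟩
  · rw [(hD z).1, (hD z).2]
    constructor
    · linear_combination -(Complex.exp (-(w z)) * (φ₁ z - φ₂ z) / 2) * hI
    · linear_combination (Complex.exp (-(w z)) * (φ₁ z - φ₂ z) / 2) * hI
  · have hx : (fun ζ => γ ζ * fderiv ℝ U ζ 1) =
        fun ζ => Complex.exp (w ζ) * (φ₁ ζ + φ₂ ζ) := by
      funext ζ
      rw [(hD ζ).1, hγ, ← mul_assoc, ← Complex.exp_add]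
      ring_nf
    have hy : (fun ζ => γ ζ * fderiv ℝ U ζ Complex.I) =
        fun ζ => Complex.exp (w ζ) * (Complex.I * (φ₁ ζ - φ₂ ζ)) := by
      funext ζ
      rw [(hD ζ).2, hγ, ← mul_assoc, ← Complex.exp_add]
      ring_nf
    rw [hx, hy, fderiv_exp_mul_apply (dw z) ((d1 z).fun_add (d2 z)),
      fderiv_exp_mul_apply (dw z) (((d1 z).fun_sub (d2 z)).const_mul Complex.I),
      fderiv_fun_add (d1 z) (d2 z), fderiv_const_mul ((d1 z).fun_sub (d2 z)),
      fderiv_fun_sub (d1 z) (d2 z)]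
    simp only [add_apply, sub_apply, smul_apply, smul_eq_mul]
    linear_combination 2 * Complex.exp (w z) * (hd1 z + hd2 z)

end
end

section
/- Let X be a complex Banach space, let U ⊆ ℂ be an open connected set containing the real interval (0,1], and let T : U → B(X) be an analytic family of bounded linear operators on X such that T(a) is a compact operator for every a ∈ U and ‖T(a)‖ → 0 as a → 0⁺ along (0,1]. Then the set { a ∈ (0,1] : Id + T(a) is not a bijective bounded linear operator of X onto itself } is finite. -/
open Complex MeasureTheory Metric Set Filter

noncomputable section

open scoped Topology

section CompactPerturbation

variable {X : Type*} [NormedAddCommGroup X] [NormedSpace ℂ X]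

/-- The kernel of a compact perturbation of the identity is finite-dimensional. -/
theorem IsCompactOperator.finiteDimensional_ker_one_add {K : X →L[ℂ] X}
    (hK : IsCompactOperator K) :
    FiniteDimensional ℂ (1 + K : X →L[ℂ] X).ker := by
  set N := (1 + K : X →L[ℂ] X).ker
  have hcl : IsClosed (N : Set X) := (1 + K : X →L[ℂ] X).isClosed_ker
  have hN : ∀ x ∈ N, -K x = x := fun x hx ↦ by
    have h : x + K x = 0 := by simpa [N] using hx
    exact (eq_neg_of_add_eq_zero_left h).symm
  have hc := (hK.neg.comp_clm N.subtypeL).codRestrict (V := N)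
    (fun x ↦ by simp [hN x x.2]) hcl
  refine FiniteDimensional.of_isCompactOperator_id (𝕜 := ℂ) ?_
  refine (?_ : _ = (id : N → N)) ▸ hc
  funext x
  exact Subtype.ext (hN x x.2)

variable [CompleteSpace X]

/-- An injective compact perturbation of the identity is bijective. -/
theorem IsCompactOperator.bijective_one_add_of_injective {K : X →L[ℂ] X}
    (hK : IsCompactOperator K) (h : Function.Injective (1 + K : X →L[ℂ] X)) :
    Function.Bijective (1 + K : X →L[ℂ] X) := by
  have h1 : ¬ Module.End.HasEigenvalue (K : Module.End ℂ X) (-1) := by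
    intro he
    obtain ⟨v, hv⟩ := he.exists_hasEigenvector
    refine hv.2 (h ?_)
    have : K v = -v := by simpa using hv.apply_eq_smul
    simp [this]
  have h2 := (hK.hasEigenvalue_or_mem_resolventSet (neg_ne_zero.2 one_ne_zero)).resolve_left h1
  rw [spectrum.mem_resolventSet_iff, ← IsUnit.neg_iff] at h2
  rw [← ContinuousLinearMap.isUnit_iff_bijective]
  convert h2 using 1
  simp [add_comm]

/-- A surjective compact perturbation of the identity is bijective. -/
theorem IsCompactOperator.bijective_one_add_of_surjective {K : X →L[ℂ] X}
    (hK : IsCompactOperator K) (h : Function.Surjective (1 + K : X →L[ℂ] X)) :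
    Function.Bijective (1 + K : X →L[ℂ] X) := by
  have := hK.finiteDimensional_ker_one_add
  obtain ⟨R, hR⟩ : (1 + K : X →L[ℂ] X).HasRightInverse := by
    set S : X →L[ℂ] X := 1 + K
    obtain ⟨P, hP⟩ := Submodule.ClosedComplemented.of_finiteDimensional S.ker
    have hinj : (S.prod P).ker = ⊥ := by
      refine LinearMap.ker_eq_bot'.2 fun x hx ↦ ?_
      obtain ⟨h1, h2⟩ := Prod.ext_iff.1 hx
      have h3 : P x = 0 := h2
      rw [hP ⟨x, h1⟩] at h3
      exact congrArg Subtype.val h3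
    have hsurj : (S.prod P).range = ⊤ := by
      refine LinearMap.range_eq_top.2 fun ⟨y, n⟩ ↦ ?_
      obtain ⟨x, rfl⟩ := h y
      have hker (m : S.ker) : S m = 0 := m.2
      exact ⟨x - P x + n, by simp [hP, hker]⟩
    refine ⟨(ContinuousLinearEquiv.ofBijective (S.prod P) hinj hsurj).symm ∘L
      ContinuousLinearMap.inl ℂ X S.ker, fun x ↦ ?_⟩
    exact congrArg Prod.fst
      ((ContinuousLinearEquiv.ofBijective (S.prod P) hinj hsurj).apply_symm_apply (x, 0))
  have hRK : R = 1 + -(K ∘L R) := by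
    ext x
    have h : R x + K (R x) = x := hR x
    simpa using eq_add_neg_of_add_eq h
  have hb : Function.Bijective R := by
    rw [hRK]
    refine IsCompactOperator.bijective_one_add_of_injective (hK.comp_clm R).neg ?_
    rw [← hRK]
    exact hR.injective
  refine ⟨fun x y hxy ↦ ?_, h⟩
  obtain ⟨x, rfl⟩ := hb.2 x
  obtain ⟨y, rfl⟩ := hb.2 y
  rw [hR, hR] at hxy
  rw [hxy]

/-- A compact perturbation of the identity becomes bijective after adding an operator
that factors through a finite-dimensional space. -/
theorem IsCompactOperator.exists_bijective_one_add_add_comp {K : X →L[ℂ] X}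
    (hK : IsCompactOperator K) :
    ∃ (N : Submodule ℂ X) (_ : FiniteDimensional ℂ N) (P : X →L[ℂ] N) (J : N →L[ℂ] X),
      Function.Bijective (1 + K + J ∘L P : X →L[ℂ] X) := by
  have hfin := hK.finiteDimensional_ker_one_add
  set S : X →L[ℂ] X := 1 + K
  obtain ⟨P, hP⟩ := Submodule.ClosedComplemented.of_finiteDimensional S.ker
  have hker (m : S.ker) : S m = 0 := m.2
  obtain ⟨s, hs⟩ := S.range.mkQ.exists_rightInverse_of_surjective S.range.range_mkQ
  have hs' (q : X ⧸ S.range) : S.range.mkQ (s q) = q := LinearMap.congr_fun hs q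
  have hQ (x : X) : S.range.mkQ (S x) = 0 := by simp
  have hcpt (J : S.ker →L[ℂ] X) : IsCompactOperator (K + J ∘L P) := by
    have := FiniteDimensional.proper ℂ S.ker
    exact hK.add ((isCompactOperator_of_locallyCompactSpace_rng J).comp_clm P)
  have hj : ∃ j : S.ker →ₗ[ℂ] X ⧸ S.range, Function.Injective j ∨ Function.Surjective j := by
    rcases le_total (Module.rank ℂ S.ker) (Module.rank ℂ (X ⧸ S.range)) with h | h
    · obtain ⟨j, hj⟩ := rank_le_iff_exists_linearMap.1 h
      exact ⟨j, .inl hj⟩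
    · obtain ⟨i, hi⟩ := rank_le_iff_exists_linearMap.1 h
      obtain ⟨j, hj⟩ := i.exists_leftInverse_of_injective (LinearMap.ker_eq_bot.2 hi)
      exact ⟨j, .inr fun q ↦ ⟨i q, LinearMap.congr_fun hj q⟩⟩
  obtain ⟨j, hj⟩ := hj
  let J : S.ker →L[ℂ] X := LinearMap.toContinuousLinearMap (s ∘ₗ j)
  have hJ (n : S.ker) : S.range.mkQ (J n) = j n := hs' (j n)
  refine ⟨S.ker, hfin, P, J, ?_⟩
  have hassoc : S + J ∘L P = 1 + (K + J ∘L P) := add_assoc _ _ _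
  rcases hj with hj | hj
  · rw [hassoc]
    refine (hcpt J).bijective_one_add_of_injective ?_
    rw [← hassoc]
    refine (injective_iff_map_eq_zero _).2 fun x hx ↦ ?_
    have hx' : S x + J (P x) = 0 := hx
    have h1 : j (P x) = 0 := by
      have := congrArg S.range.mkQ hx'
      rwa [map_add, hQ, hJ, zero_add, map_zero] at this
    have h2 : P x = 0 := hj (h1.trans (map_zero j).symm)
    rw [h2, map_zero, add_zero] at hx'
    rw [hP ⟨x, hx'⟩] at h2
    exact congrArg Subtype.val h2
  · rw [hassoc]
    refine (hcpt J).bijective_one_add_of_surjective ?_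
    rw [← hassoc]
    intro y
    obtain ⟨n, hn⟩ := hj (S.range.mkQ y)
    have h1 : y - J n ∈ S.range := by
      rw [← Submodule.ker_mkQ S.range, LinearMap.mem_ker, map_sub, hJ, hn, sub_self]
    obtain ⟨x, hx⟩ := h1
    have hx' : S x = y - J n := hx
    exact ⟨x - P x + n, by simp [hP, hker, hx']⟩

end CompactPerturbation

/-- If `1 - B ∘ J` is bijective, then so is `1 - J ∘ B`. -/
theorem ContinuousLinearMap.bijective_one_sub_comp_comm {X N : Type*}
    [NormedAddCommGroup X] [NormedSpace ℂ X] [NormedAddCommGroup N] [NormedSpace ℂ N]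
    (J : N →L[ℂ] X) (B : X →L[ℂ] N)
    (h : Function.Bijective (1 - B ∘L J : N →L[ℂ] N)) :
    Function.Bijective (1 - J ∘L B : X →L[ℂ] X) := by
  refine ⟨(injective_iff_map_eq_zero _).2 fun x hx ↦ ?_, fun y ↦ ?_⟩
  · have hx' : x - J (B x) = 0 := hx
    have h1 : B x = 0 := by
      refine (injective_iff_map_eq_zero _).1 h.1 _ ?_
      have := congrArg B hx'
      simpa using this
    simpa [h1] using hx'
  · obtain ⟨n, hn⟩ := h.2 (B y)
    have hn' : n - B (J n) = B y := hn
    refine ⟨y + J n, ?_⟩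
    have h2 : B y + B (J n) = n := by rw [← hn', sub_add_cancel]
    change y + J n - J (B (y + J n)) = y
    rw [map_add, h2, add_sub_cancel_right]

/-- The determinant of an analytic family of operators on a finite-dimensional space is
analytic. -/
theorem AnalyticAt.det {N : Type*} [NormedAddCommGroup N] [NormedSpace ℂ N]
    [FiniteDimensional ℂ N] {f : ℂ → N →L[ℂ] N} {z₀ : ℂ} (hf : AnalyticAt ℂ f z₀) :
    AnalyticAt ℂ (fun z ↦ LinearMap.det (f z : N →ₗ[ℂ] N)) z₀ := by
  classical
  let b := Module.finBasis ℂ N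
  simp_rw [← LinearMap.det_toMatrix b, Matrix.det_apply']
  refine Finset.analyticAt_fun_sum _ fun σ _ ↦ analyticAt_const.mul ?_
  refine Finset.analyticAt_fun_prod _ fun i _ ↦ ?_
  let c : N →L[ℂ] ℂ := LinearMap.toContinuousLinearMap (b.coord (σ i))
  have h := ((c ∘L ContinuousLinearMap.apply ℂ N (b i)).analyticAt (f z₀)).comp hf
  refine h.congr (.of_forall fun z ↦ ?_)
  simp [c, LinearMap.toMatrix_apply]

/-- **Local analytic Fredholm alternative**: near each point, an analytic family of compact
perturbations of the identity is either invertible on a punctured neighborhood or nowhere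
invertible. -/
theorem AnalyticAt.eventually_bijective_or_eventually_not_bijective {X : Type*}
    [NormedAddCommGroup X] [NormedSpace ℂ X] [CompleteSpace X] {T : ℂ → X →L[ℂ] X} {z₀ : ℂ}
    (hT : AnalyticAt ℂ T z₀) (hcpt : IsCompactOperator (T z₀)) :
    (∀ᶠ z in 𝓝[≠] z₀, Function.Bijective (1 + T z : X →L[ℂ] X)) ∨
      ∀ᶠ z in 𝓝 z₀, ¬ Function.Bijective (1 + T z : X →L[ℂ] X) := by
  obtain ⟨N, _, P, J, hbij⟩ := hcpt.exists_bijective_one_add_add_comp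
  let A : ℂ → X →L[ℂ] X := fun z ↦ 1 + T z + J ∘L P
  have hA : AnalyticAt ℂ A z₀ := (analyticAt_const.add hT).add analyticAt_const
  obtain ⟨u, hu⟩ : IsUnit (A z₀) := ContinuousLinearMap.isUnit_iff_bijective.2 hbij
  have hunit : ∀ᶠ z in 𝓝 z₀, IsUnit (A z) :=
    hA.continuousAt.eventually (Units.isOpen.mem_nhds ⟨u, hu⟩)
  have hinv : AnalyticAt ℂ (fun z ↦ Ring.inverse (A z)) z₀ := by
    have h := analyticAt_inverse (𝕜 := ℂ) u
    rw [hu] at h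
    exact h.comp hA
  let D : ℂ → N →L[ℂ] N := fun z ↦ 1 - (P ∘L Ring.inverse (A z)) ∘L J
  have hD : AnalyticAt ℂ D z₀ := by
    refine analyticAt_const.sub ?_
    exact (((ContinuousLinearMap.compL ℂ N X N).flip J ∘L
      ContinuousLinearMap.compL ℂ X X N P).analyticAt _).comp hinv
  have key : ∀ᶠ z in 𝓝 z₀, (Function.Bijective (1 + T z : X →L[ℂ] X) ↔
      LinearMap.det (D z : N →ₗ[ℂ] N) ≠ 0) := by
    filter_upwards [hunit] with z hz
    have hfac : 1 + T z = (1 - J ∘L (P ∘L Ring.inverse (A z))) * A z := by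
      have h1 : (J ∘L (P ∘L Ring.inverse (A z))) * A z = J ∘L P := by
        change (J ∘L P) * Ring.inverse (A z) * A z = J ∘L P
        rw [mul_assoc, Ring.inverse_mul_cancel _ hz, mul_one]
      rw [sub_mul, one_mul, h1]
      simp [A]
    rw [← isUnit_iff_ne_zero, ← LinearMap.isUnit_iff_isUnit_det, Module.End.isUnit_iff,
      ← ContinuousLinearMap.isUnit_iff_bijective, hfac, IsUnit.mul_right_iff hz,
      ContinuousLinearMap.isUnit_iff_bijective]
    exact ⟨ContinuousLinearMap.bijective_one_sub_comp_comm _ _,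
      ContinuousLinearMap.bijective_one_sub_comp_comm _ _⟩
  rcases hD.det.eventually_eq_zero_or_eventually_ne_zero with h | h
  · right
    filter_upwards [key, h] with z h1 h2 h3
    exact h1.1 h3 h2
  · left
    filter_upwards [key.filter_mono nhdsWithin_le_nhds, h] with z h1 h2
    exact h1.2 h2

/-- **Analytic Fredholm alternative**: an analytic family, on a preconnected set, of compact
perturbations of the identity that is invertible somewhere is invertible on a punctured
neighborhood of each point. -/
theorem AnalyticOnNhd.eventually_bijective_one_add {X : Type*}
    [NormedAddCommGroup X] [NormedSpace ℂ X] [CompleteSpace X] {U : Set ℂ}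
    (hU : IsPreconnected U) {T : ℂ → X →L[ℂ] X} (hT : AnalyticOnNhd ℂ T U)
    (hcpt : ∀ z ∈ U, IsCompactOperator (T z)) {z₁ : ℂ} (hz₁ : z₁ ∈ U)
    (h₁ : Function.Bijective (1 + T z₁ : X →L[ℂ] X)) {z : ℂ} (hz : z ∈ U) :
    ∀ᶠ w in 𝓝[≠] z, Function.Bijective (1 + T w : X →L[ℂ] X) := by
  have dich (w : ℂ) (hw : w ∈ U) :=
    (hT w hw).eventually_bijective_or_eventually_not_bijective (hcpt w hw)
  refine (dich z hz).resolve_right fun hzV ↦ ?_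
  let V : Set ℂ := {w | ∀ᶠ x in 𝓝 w, ¬ Function.Bijective (1 + T x : X →L[ℂ] X)}
  have hsub : U ⊆ V := by
    refine hU.subset_of_closure_inter_subset isOpen_setOfPred_eventually_nhds ⟨z, hz, hzV⟩ ?_
    rintro w ⟨hw, hwU⟩
    refine (dich w hwU).resolve_left fun hb ↦ ?_
    obtain ⟨x, hx, hxV⟩ := ((mem_closure_iff_frequently.1 hw).and_eventually
      (eventually_nhdsWithin_iff.1 hb)).exists
    by_cases hxw : x = w
    · subst hxw
      exact ((hx.filter_mono nhdsWithin_le_nhds).and hb).exists.elim fun _ h ↦ h.1 h.2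
    · exact hx.self_of_nhds (hxV hxw)
  exact (hsub hz₁).self_of_nhds h₁

/-- STATEMENT 13 (analytic Fredholm alternative on (0,1]): if T is an analytic family of
compact operators on a complex Banach space X, defined on an open connected set U ⊆ ℂ
containing the interval (0,1], with ‖T(a)‖ → 0 as a → 0⁺ along (0,1], then Id + T(a) fails
to be bijective for at most finitely many a ∈ (0,1]. -/
theorem stmt13 (X : Type*) [NormedAddCommGroup X] [NormedSpace ℂ X] [CompleteSpace X]
    (U : Set ℂ) (hU : IsOpen U) (hconn : IsConnected U)
    (hsub : ∀ a : ℝ, a ∈ Set.Ioc (0:ℝ) 1 → (a : ℂ) ∈ U)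
    (T : ℂ → X →L[ℂ] X)
    (hT : AnalyticOnNhd ℂ T U)
    (hcpt : ∀ a ∈ U, IsCompactOperator (T a))
    (hlim : Filter.Tendsto (fun a : ℝ => ‖T (a : ℂ)‖)
      (nhdsWithin 0 (Set.Ioc (0:ℝ) 1)) (nhds 0)) :
    {a : ℝ | a ∈ Set.Ioc (0:ℝ) 1
      ∧ ¬ Function.Bijective (ContinuousLinearMap.id ℂ X + T (a : ℂ))}.Finite := by
  change {a : ℝ | a ∈ Set.Ioc (0:ℝ) 1 ∧
    ¬ Function.Bijective (1 + T (a : ℂ) : X →L[ℂ] X)}.Finite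
  obtain ⟨ε, hε, hsmall⟩ : ∃ ε > 0, ∀ a ∈ Set.Ioc (0:ℝ) 1, a < ε →
      Function.Bijective (1 + T (a : ℂ) : X →L[ℂ] X) := by
    obtain ⟨ε, hε, h⟩ := Metric.mem_nhdsWithin_iff.1 (hlim.eventually (gt_mem_nhds one_pos))
    refine ⟨ε, hε, fun a ha haε ↦ ?_⟩
    have hlt : ‖T (a : ℂ)‖ < 1 := h ⟨by simpa [abs_of_pos ha.1] using haε, ha⟩
    rw [← ContinuousLinearMap.isUnit_iff_bijective, ← sub_neg_eq_add]
    exact isUnit_one_sub_of_norm_lt_one (by rwa [norm_neg])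
  have hloc (x : ℝ) (hx : x ∈ Set.Ioc (0:ℝ) 1) :
      ∀ᶠ w in 𝓝[≠] (x : ℂ), Function.Bijective (1 + T w : X →L[ℂ] X) := by
    have ha : min (ε / 2) 1 ∈ Set.Ioc (0:ℝ) 1 := ⟨by positivity, min_le_right _ _⟩
    exact hT.eventually_bijective_one_add hconn.isPreconnected hcpt (hsub _ ha)
      (hsmall _ ha ((min_le_left _ _).trans_lt (half_lt_self hε))) (hsub x hx)
  by_contra hinf
  obtain ⟨x, hx, hacc⟩ := Set.Infinite.exists_accPt_of_subset_isCompact hinf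
    (isCompact_Icc (a := ε) (b := 1))
    fun a ha ↦ ⟨not_lt.1 fun h ↦ ha.2 (hsmall a ha.1 h), ha.1.2⟩
  have htend : Tendsto ((↑) : ℝ → ℂ) (𝓝[≠] x) (𝓝[≠] (x : ℂ)) :=
    Complex.continuous_ofReal.continuousAt.tendsto.inf
      (tendsto_principal_principal.2 fun y hy ↦ by simpa using hy)
  obtain ⟨y, hy, hy'⟩ := ((accPt_iff_frequently_nhdsNE.1 hacc).and_eventually
    (htend.eventually (hloc x ⟨hε.trans_le hx.1, hx.2⟩))).exists
  exact hy.2 hy'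

end
end
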